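/- Let X = (X, 𝒳, μ, (T_t)_{t∈ℝ}) be an ergodic ℝ-system. Let J be a nonempty countable index set, let (c_j)_{j∈J} be positive reals with Σ_{j∈J} c_j = 1, and let (α_j)_{j∈J} be pairwise distinct real numbers. Let f : X → ℂ be bounded and measurable with ∫_X f dμ = 0. Then lim_{T→∞} (1/T) ∫₀^T ∫_X |Σ_{j∈J} c_j f(T_{tα_j} x)|² dμ(x) dt = (Σ_{j∈J} c_j²) · ∫_X |f|² dμ. -/

import Mathlib

open MeasureTheory Filter Topology

structure RSystem (m : ℕ) (X : Type*) [MeasurableSpace X] (μ : Measure X) where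
  T : (Fin m → ℝ) → X → X
  measurable_pair : Measurable fun p : (Fin m → ℝ) × X => T p.1 p.2
  measurePreserving : ∀ α, MeasurePreserving (T α) μ μ
  T_zero : T 0 = id
  T_add : ∀ α β, T α ∘ T β = T (α + β)
  separableL2 : TopologicalSpace.SeparableSpace (Lp ℂ 2 μ)

namespace RSystem

variable {m : ℕ} {X : Type*} [MeasurableSpace X] {μ : Measure X}

/-- The system is ergodic. -/
def IsErgodic (S : RSystem m X μ) : Prop :=
  ∀ A : Set X, MeasurableSet A → (∀ α, μ (symmDiff (S.T α ⁻¹' A) A) = 0) →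
    μ A = 0 ∨ μ A = 1

end RSystem

/-- A set of reals has density one. -/
def HasDensityOne (A : Set ℝ) : Prop :=
  Tendsto (fun T' : ℝ => (volume (A ∩ Set.Icc 0 T')).toReal / T') atTop (nhds 1)

namespace RSystem

variable {m : ℕ} {X : Type*} [MeasurableSpace X] {μ : Measure X}

/-- `ν` is weakly equidistributed for the system. -/
def WeaklyEquidistributed (S : RSystem m X μ) (ν : Measure (Fin m → ℝ)) : Prop :=
  ∃ A : Set ℝ, MeasurableSet A ∧ HasDensityOne A ∧
    ∀ f : X → ℂ, Measurable f → (∃ C, ∀ x, ‖f x‖ ≤ C) →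
      ∀ᵐ x ∂μ, Tendsto (fun t : ℝ => ∫ α, f (S.T (t • α) x) ∂ν)
        (atTop ⊓ Filter.principal A) (nhds (∫ x, f x ∂μ))

/-- The system is good for double Birkhoff averages. -/
def GoodForDoubleBirkhoff (S : RSystem m X μ) : Prop :=
  ∀ (f₁ f₂ : X → ℂ), Measurable f₁ → Measurable f₂ →
    (∃ C, ∀ x, ‖f₁ x‖ ≤ C) → (∃ C, ∀ x, ‖f₂ x‖ ≤ C) →
    ∀ α₁ α₂ : Fin m → ℝ, ∀ᵐ x ∂μ, ∃ L : ℂ,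
      Tendsto (fun T' : ℝ => (1 / T' : ℝ) •
          ∫ t in Set.Ioc (0:ℝ) T', f₁ (S.T (t • α₁) x) * f₂ (S.T (t • α₂) x))
        atTop (nhds L)

/-- The σ-algebra (collection of sets) invariant under `T_g`, `g ∈ H`, up to null sets. -/
def InvSets (S : RSystem m X μ) (H : Set (Fin m → ℝ)) : Set (Set X) :=
  {A | MeasurableSet A ∧ ∀ g ∈ H, μ (symmDiff (S.T g ⁻¹' A) A) = 0}

/-- The set of non-ergodic directions. -/
def W (S : RSystem m X μ) : Set (Fin m → ℝ) :=
  {α | S.InvSets (Set.range fun t : ℝ => t • α) ≠ S.InvSets Set.univ}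

end RSystem

/-- A hyperplane of `ℝ^m`: a translate of an `(m-1)`-dimensional linear subspace. -/
def IsHyperplane (m : ℕ) (ℓ : Set (Fin m → ℝ)) : Prop :=
  ∃ (V : Submodule ℝ (Fin m → ℝ)) (β : Fin m → ℝ),
    Module.finrank ℝ V = m - 1 ∧ ℓ = (fun v => v + β) '' (V : Set (Fin m → ℝ))

/-- The average over `(0, T]` of a complex function of time. -/
noncomputable def timeAverage (ψ : ℝ → ℂ) (T : ℝ) : ℂ :=
  (1 / T) • ∫ t in Set.Ioc (0 : ℝ) T, ψ t

lemma norm_timeAverage_le {ψ : ℝ → ℂ} {C T : ℝ} (hψ : ∀ t, ‖ψ t‖ ≤ C) (hT : 0 < T) :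
    ‖timeAverage ψ T‖ ≤ C := by
  have h := norm_setIntegral_le_of_norm_le_const (μ := volume) (s := Set.Ioc (0 : ℝ) T) (f := ψ)
    (C := C) measure_Ioc_lt_top (fun t _ => hψ t)
  rw [Real.volume_real_Ioc_of_le hT.le, sub_zero] at h
  rw [timeAverage, norm_smul, Real.norm_of_nonneg (by positivity)]
  calc 1 / T * ‖∫ t in Set.Ioc (0 : ℝ) T, ψ t‖ ≤ 1 / T * (C * T) := by gcongr
    _ = C := by field_simp

lemma integrable_of_measurable_of_norm_le {Y : Type*} [MeasurableSpace Y] {ν : Measure Y}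
    [IsFiniteMeasure ν] {ψ : Y → ℂ} {C : ℝ} (hm : Measurable ψ)
    (hb : ∀ t, ‖ψ t‖ ≤ C) : Integrable ψ ν :=
  Integrable.of_bound hm.aestronglyMeasurable C (Eventually.of_forall hb)

lemma timeAverage_add {ψ φ : ℝ → ℂ} {C D : ℝ} (hψ : Measurable ψ) (hφ : Measurable φ)
    (hψb : ∀ t, ‖ψ t‖ ≤ C) (hφb : ∀ t, ‖φ t‖ ≤ D) (T : ℝ) :
    timeAverage (fun t => ψ t + φ t) T = timeAverage ψ T + timeAverage φ T := by
  rw [timeAverage, integral_add (integrable_of_measurable_of_norm_le hψ hψb)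
    (integrable_of_measurable_of_norm_le hφ hφb), smul_add, timeAverage, timeAverage]

/-- The time average of the increment `ψ (t + s) - ψ t` of a bounded function vanishes. -/
lemma tendsto_timeAverage_increment {ψ : ℝ → ℂ} {C : ℝ} (hψ : Measurable ψ)
    (hb : ∀ t, ‖ψ t‖ ≤ C) (s : ℝ) :
    Tendsto (timeAverage fun t => ψ (t + s) - ψ t) atTop (𝓝 0) := by
  have hi : ∀ a b, IntervalIntegrable ψ volume a b := fun a b =>
    ⟨integrable_of_measurable_of_norm_le hψ hb, integrable_of_measurable_of_norm_le hψ hb⟩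
  have hlim : Tendsto (fun T : ℝ => 1 / T * (2 * (C * |s|))) atTop (𝓝 0) := by
    simpa using tendsto_inv_atTop_zero.mul_const (2 * (C * |s|))
  have hi' : ∀ a b, IntervalIntegrable (fun t => ψ (t + s)) volume a b := fun a b =>
    have hm : Measurable fun t => ψ (t + s) := hψ.comp (measurable_add_const s)
    ⟨integrable_of_measurable_of_norm_le hm fun t => hb (t + s),
      integrable_of_measurable_of_norm_le hm fun t => hb (t + s)⟩
  refine squeeze_zero_norm' ?_ hlim
  filter_upwards [eventually_gt_atTop 0] with T hT
  rw [timeAverage, norm_smul, Real.norm_of_nonneg (by positivity)]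
  gcongr
  rw [← intervalIntegral.integral_of_le hT.le, intervalIntegral.integral_sub
    (hi' _ _) (hi _ _), intervalIntegral.integral_comp_add_right,
    intervalIntegral.integral_interval_sub_interval_comm' (hi _ _) (hi _ _) (hi _ _)]
  have h₁ := intervalIntegral.norm_integral_le_of_norm_le_const (f := ψ) (a := T) (b := T + s)
    (fun t _ => hb t)
  have h₂ := intervalIntegral.norm_integral_le_of_norm_le_const (f := ψ) (a := 0) (b := 0 + s)
    (fun t _ => hb t)
  simp only [add_sub_cancel_left] at h₁ h₂
  exact (norm_sub_le _ _).trans (by linarith)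

section MeanErgodic

variable {H : Type*} [NormedAddCommGroup H] [InnerProductSpace ℂ H]

/-- If every `U s u - u` is orthogonal to `g`, then `g` is invariant under `U`. -/
lemma invariant_of_forall_inner_increment_eq_zero {U : ℝ → H →ₗᵢ[ℂ] H}
    (h_zero : ∀ v, U 0 v = v) (h_add : ∀ s t v, U (s + t) v = U s (U t v)) {g : H}
    (hg : ∀ s u, inner ℂ (U s u - u) g = 0) (s : ℝ) : U s g = g := by
  have h₁ : inner ℂ (U s g - g) (U s g) = 0 := by
    have h := hg (-s) g
    rw [← (U s).inner_map_map, map_sub, ← h_add, add_neg_cancel, h_zero] at h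
    rw [← neg_sub, inner_neg_left, h, neg_zero]
  have h₂ : inner ℂ (U s g - g) (U s g - g) = 0 := by
    rw [inner_sub_right, h₁, hg, sub_zero]
  exact sub_eq_zero.1 (inner_self_eq_zero.1 h₂)

/-- The weak mean ergodic theorem for a measurable one-parameter group of isometries, on the
orthogonal complement of the invariant vectors. -/
theorem tendsto_timeAverage_inner [CompleteSpace H] {U : ℝ → H →ₗᵢ[ℂ] H}
    (h_zero : ∀ v, U 0 v = v) (h_add : ∀ s t v, U (s + t) v = U s (U t v))
    (h_meas : ∀ v w, Measurable fun t => inner ℂ w (U t v)) {v : H}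
    (hv : ∀ g, (∀ s, U s g = g) → inner ℂ g v = 0) (w : H) :
    Tendsto (timeAverage fun t => inner ℂ w (U t v)) atTop (𝓝 0) := by
  have hbound : ∀ u t, ‖inner ℂ w (U t u)‖ ≤ ‖w‖ * ‖u‖ := fun u t => by
    simpa using norm_inner_le_norm (𝕜 := ℂ) w (U t u)
  set K : Submodule ℂ H := Submodule.span ℂ (Set.range fun p : ℝ × H => U p.1 p.2 - p.2)
  have hK : ∀ u ∈ K, Tendsto (timeAverage fun t => inner ℂ w (U t u)) atTop (𝓝 0) := by
    intro u hu
    induction hu using Submodule.span_induction with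
    | mem x hx =>
      obtain ⟨⟨s, u⟩, rfl⟩ := hx
      simpa only [map_sub, inner_sub_right, h_add] using
        tendsto_timeAverage_increment (h_meas u w) (hbound u) s
    | zero =>
      have h : (timeAverage fun _ => 0) = fun _ => 0 := by
        funext T
        simp [timeAverage]
      simp [h]
    | add x y _ _ hx hy =>
      refine (by simpa using hx.add hy : Tendsto _ atTop (𝓝 (0 : ℂ))).congr fun T => ?_
      simp only [map_add, inner_add_right]
      exact (timeAverage_add (h_meas x w) (h_meas y w) (hbound x) (hbound y) T).symm
    | smul a x _ hx =>
      refine (by simpa using hx.const_mul a : Tendsto _ atTop (𝓝 (0 : ℂ))).congr fun T => ?_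
      simp only [map_smul, inner_smul_right, timeAverage, integral_const_mul, mul_smul_comm]
  have hvK : v ∈ K.topologicalClosure := by
    rw [← Submodule.orthogonal_orthogonal_eq_closure, Submodule.mem_orthogonal]
    exact fun g hg => hv g <| invariant_of_forall_inner_increment_eq_zero h_zero h_add
      fun s u => (Submodule.mem_orthogonal _ _).1 hg _ (Submodule.subset_span ⟨(s, u), rfl⟩)
  rw [Metric.tendsto_nhds]
  intro ε hε
  obtain ⟨u, huK, hu⟩ := Metric.mem_closure_iff.1 hvK (ε / 2 / (‖w‖ + 1)) (by positivity)
  filter_upwards [Metric.tendsto_nhds.1 (hK u huK) (ε / 2) (by positivity),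
    eventually_gt_atTop 0] with T hT hT0
  have hsplit : timeAverage (fun t => inner ℂ w (U t v)) T =
      timeAverage (fun t => inner ℂ w (U t (v - u))) T +
        timeAverage (fun t => inner ℂ w (U t u)) T := by
    rw [← timeAverage_add (h_meas _ w) (h_meas _ w) (hbound _) (hbound _)]
    simp
  rw [dist_zero_right] at hT ⊢
  rw [hsplit]
  have hsmall : ‖w‖ * ‖v - u‖ ≤ ε / 2 := by
    rw [dist_eq_norm, lt_div_iff₀ (by positivity)] at hu
    nlinarith [norm_nonneg (v - u)]
  linarith [norm_add_le (timeAverage (fun t => inner ℂ w (U t (v - u))) T)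
    (timeAverage (fun t => inner ℂ w (U t u)) T),
    norm_timeAverage_le (hbound (v - u)) hT0]

end MeanErgodic

namespace RSystem

variable {X : Type*} [MeasurableSpace X] {μ : Measure X}

/-- The Koopman representation of an `ℝ`-system on `L²`. -/
noncomputable def koopman (S : RSystem 1 X μ) (s : ℝ) : Lp ℂ 2 μ →ₗᵢ[ℂ] Lp ℂ 2 μ :=
  Lp.compMeasurePreservingₗᵢ ℂ (S.T fun _ => s) (S.measurePreserving _)

lemma coeFn_koopman (S : RSystem 1 X μ) (s : ℝ) (v : Lp ℂ 2 μ) :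
    S.koopman s v =ᵐ[μ] v ∘ S.T fun _ => s :=
  Lp.coeFn_compMeasurePreserving v (S.measurePreserving _)

lemma koopman_toLp (S : RSystem 1 X μ) (s : ℝ) {f : X → ℂ} (hf : MemLp f 2 μ) :
    S.koopman s (hf.toLp f) =
      (hf.comp_measurePreserving (S.measurePreserving fun _ => s)).toLp _ :=
  Lp.toLp_compMeasurePreserving hf (S.measurePreserving _)

lemma koopman_zero (S : RSystem 1 X μ) (v : Lp ℂ 2 μ) : S.koopman 0 v = v := by
  refine Lp.ext ((S.coeFn_koopman 0 v).trans ?_)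
  have h : S.T (fun _ => 0) = id := S.T_zero
  rw [h, Function.comp_id]

lemma koopman_add (S : RSystem 1 X μ) (s t : ℝ) (v : Lp ℂ 2 μ) :
    S.koopman (s + t) v = S.koopman s (S.koopman t v) := by
  refine Lp.ext ((S.coeFn_koopman _ v).trans ?_)
  have h : S.T (fun _ => s + t) = (S.T fun _ => t) ∘ S.T fun _ => s := by
    rw [S.T_add, add_comm]
    rfl
  rw [h, ← Function.comp_assoc]
  exact ((S.measurePreserving _).quasiMeasurePreserving.ae_eq_comp
    (S.coeFn_koopman t v)).symm.trans (S.coeFn_koopman s _).symm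

lemma measurable_inner_koopman [IsProbabilityMeasure μ] (S : RSystem 1 X μ) (v w : Lp ℂ 2 μ) :
    Measurable fun t => inner ℂ w (S.koopman t v) := by
  have hT : Measurable fun p : ℝ × X => S.T (fun _ => p.1) p.2 :=
    S.measurable_pair.comp
      ((measurable_pi_lambda _ fun _ => measurable_fst).prodMk measurable_snd)
  have h : ∀ t, inner ℂ w (S.koopman t v) = ∫ x, inner ℂ (w x) (v (S.T (fun _ => t) x)) ∂μ := by
    intro t
    rw [L2.inner_def]
    refine integral_congr_ae ?_
    filter_upwards [S.coeFn_koopman t v] with x hx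
    rw [hx, Function.comp_apply]
  simp only [h]
  refine StronglyMeasurable.measurable (StronglyMeasurable.integral_prod_right
    (f := fun t x => inner ℂ (w x) (v (S.T (fun _ => t) x))) ?_)
  exact ((Lp.stronglyMeasurable w).comp_measurable measurable_snd).inner
    ((Lp.stronglyMeasurable v).comp_measurable hT)

/-- For an ergodic system, the functions invariant under the Koopman representation are
almost everywhere constant. -/
lemma IsErgodic.ae_eq_const [IsProbabilityMeasure μ] {S : RSystem 1 X μ} (hS : S.IsErgodic)
    {g : Lp ℂ 2 μ} (hg : ∀ s, S.koopman s g = g) : ∃ a : ℂ, g =ᵐ[μ] Function.const X a := by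
  refine exists_eventuallyEq_const_of_forall_separating MeasurableSet fun B hB => ?_
  have hA : MeasurableSet (g ⁻¹' B) := (Lp.stronglyMeasurable g).measurable hB
  have hinv : ∀ α, μ (symmDiff (S.T α ⁻¹' (g ⁻¹' B)) (g ⁻¹' B)) = 0 := by
    intro α
    have hα : α = fun _ => α 0 := by
      ext i
      rw [Subsingleton.elim i 0]
    have h := S.coeFn_koopman (α 0) g
    rw [hg, ← hα] at h
    rw [measure_symmDiff_eq_zero_iff]
    filter_upwards [h] with x hx
    exact congrArg B (hx.symm)
  rcases hS _ hA hinv with h | h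
  · exact Or.inr (measure_eq_zero_iff_ae_notMem.1 h)
  · exact Or.inl ((mem_ae_iff_prob_eq_one hA).2 h)

/-- Time averages of the correlations of a function of mean zero along a nontrivial direction
vanish. -/
lemma IsErgodic.tendsto_timeAverage_correlation [IsProbabilityMeasure μ] {S : RSystem 1 X μ}
    (hS : S.IsErgodic) {v : Lp ℂ 2 μ} (hv : ∫ x, v x ∂μ = 0) (w : Lp ℂ 2 μ) {β : ℝ}
    (hβ : β ≠ 0) : Tendsto (timeAverage fun t => inner ℂ w (S.koopman (t * β) v)) atTop (𝓝 0) := by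
  refine tendsto_timeAverage_inner (U := fun t => S.koopman (t * β)) ?_ ?_ ?_ ?_ w
  · simp [koopman_zero]
  · simp [add_mul, koopman_add]
  · exact fun v w => (S.measurable_inner_koopman v w).comp (measurable_id.mul_const β)
  · intro g hg
    obtain ⟨a, ha⟩ := hS.ae_eq_const (g := g) fun s => by
      simpa [hβ] using hg (s / β)
    rw [L2.inner_def, integral_congr_ae (g := fun x => v x * starRingEnd ℂ a),
      integral_mul_const, hv, zero_mul]
    filter_upwards [ha] with x hx
    rw [hx]
    rfl

end RSystem

/-- The square of the norm of an absolutely convergent series as a double series. -/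
lemma hasSum_mul_conj_of_summable_norm {J : Type*} {a : J → ℂ} (ha : Summable fun j => ‖a j‖) :
    HasSum (fun p : J × J => a p.1 * starRingEnd ℂ (a p.2)) ((‖∑' j, a j‖ ^ 2 : ℝ) : ℂ) := by
  have hb : Summable fun j => ‖starRingEnd ℂ (a j)‖ := by simpa using ha
  have h := (summable_mul_of_summable_norm ha hb).hasSum
  rw [← tsum_mul_tsum_of_summable_norm ha hb, ← Complex.conj_tsum, Complex.mul_conj,
    Complex.normSq_eq_norm_sq] at h
  exact h

/-- Expansion of the squared `L²` norm of a countable combination of translates of a bounded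
function in terms of its correlations. -/
lemma RSystem.hasSum_integral_norm_sq_combination {X : Type*} [MeasurableSpace X] {μ : Measure X}
    [IsProbabilityMeasure μ] (S : RSystem 1 X μ) {J : Type*} [Countable J] {c : J → ℝ}
    (hc : Summable fun j => ‖(c j : ℂ)‖) (β : J → ℝ) {f : X → ℂ} (hf : Measurable f) {C : ℝ}
    (hC : ∀ x, ‖f x‖ ≤ C) (hfL : MemLp f 2 μ) {v : Lp ℂ 2 μ} (hv_def : v = hfL.toLp f) :
    HasSum (fun p : J × J => (c p.1 : ℂ) * c p.2 * inner ℂ v (S.koopman (β p.1 - β p.2) v))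
      ((∫ x, ‖∑' j, (c j : ℂ) * f (S.T (fun _ => β j) x)‖ ^ 2 ∂μ : ℝ) : ℂ) := by
  have hTm : ∀ s : ℝ, Measurable (S.T fun _ => s) := fun s => (S.measurePreserving _).measurable
  set F : J × J → X → ℂ := fun p x =>
    ((c p.1 : ℂ) * f (S.T (fun _ => β p.1) x)) *
      starRingEnd ℂ ((c p.2 : ℂ) * f (S.T (fun _ => β p.2) x)) with hF
  have hFb : ∀ p x, ‖F p x‖ ≤ ‖(c p.1 : ℂ) * c p.2‖ * (C * C) := by
    intro p x
    have h₁ := hC (S.T (fun _ => β p.1) x)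
    have h₂ := hC (S.T (fun _ => β p.2) x)
    calc ‖F p x‖ = ‖(c p.1 : ℂ) * c p.2‖ * (‖f (S.T (fun _ => β p.1) x)‖ *
          ‖f (S.T (fun _ => β p.2) x)‖) := by
          simp only [hF, norm_mul, RCLike.norm_conj]
          ring
      _ ≤ ‖(c p.1 : ℂ) * c p.2‖ * (C * C) := by
          have := (norm_nonneg _).trans h₁
          gcongr
  have hFm : ∀ p, Measurable (F p) := fun p =>
    ((hf.comp (hTm _)).const_mul _).mul
      (Complex.continuous_conj.measurable.comp ((hf.comp (hTm _)).const_mul _))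
  have hFi : ∀ p, ∫ x, F p x ∂μ =
      (c p.1 : ℂ) * c p.2 * inner ℂ v (S.koopman (β p.1 - β p.2) v) := by
    intro p
    have hinner : inner ℂ v (S.koopman (β p.1 - β p.2) v) =
        inner ℂ (S.koopman (β p.2) v) (S.koopman (β p.1) v) := by
      rw [← (S.koopman (β p.2)).inner_map_map, ← S.koopman_add, add_sub_cancel]
    rw [hinner, L2.inner_def, ← integral_const_mul]
    refine integral_congr_ae ?_
    rw [hv_def, S.koopman_toLp, S.koopman_toLp]
    filter_upwards [(hfL.comp_measurePreserving
        (S.measurePreserving fun _ => β p.1)).coeFn_toLp,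
      (hfL.comp_measurePreserving
        (S.measurePreserving fun _ => β p.2)).coeFn_toLp] with x h₁ h₂
    rw [h₁, h₂]
    simp only [hF, RCLike.inner_apply, Function.comp_apply, map_mul, Complex.conj_ofReal]
    ring
  have hsumF := hasSum_integral_of_summable_integral_norm (μ := μ) (F := F)
    (fun p => integrable_of_measurable_of_norm_le (hFm p) (hFb p))
    (Summable.of_nonneg_of_le (fun p => integral_nonneg fun _ => norm_nonneg _)
      (fun p => by
        refine (integral_mono_of_nonneg (Eventually.of_forall fun _ => norm_nonneg _)
          (integrable_const (‖(c p.1 : ℂ) * c p.2‖ * (C * C)))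
          (Eventually.of_forall (hFb p))).trans ?_
        simp) ((hc.mul_norm hc).mul_right (C * C)))
  simp only [hFi] at hsumF
  have hsq : ∫ x, ∑' p, F p x ∂μ =
      ((∫ x, ‖∑' j, (c j : ℂ) * f (S.T (fun _ => β j) x)‖ ^ 2 ∂μ : ℝ) : ℂ) := by
    rw [← integral_complex_ofReal]
    refine integral_congr_ae (Eventually.of_forall fun x => ?_)
    refine HasSum.tsum_eq (hasSum_mul_conj_of_summable_norm
      (a := fun j => (c j : ℂ) * f (S.T (fun _ => β j) x)) ?_)
    refine Summable.of_nonneg_of_le (fun _ => norm_nonneg _) (fun j => ?_) (hc.mul_right C)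
    rw [norm_mul]
    gcongr
    exact hC _
  rwa [hsq] at hsumF

/-- For an ergodic `ℝ`-system, a countable convex combination with
coefficients `c_j` along pairwise distinct directions `α_j`, and a bounded measurable `f`
with `∫ f dμ = 0`, the time average of `∫_X |∑_j c_j f(T_{tα_j}x)|² dμ` converges to
`(∑_j c_j²)·∫_X |f|² dμ`. -/
theorem time_average_of_countable_combination
    (X : Type) [MeasurableSpace X] (μ : Measure X) [IsProbabilityMeasure μ]
    (S : RSystem 1 X μ) (hS : S.IsErgodic)
    (J : Type) [Countable J] [Nonempty J]
    (c : J → ℝ) (hc : ∀ j, 0 < c j) (hsum : HasSum c 1)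
    (α : J → ℝ) (hα : Function.Injective α)
    (f : X → ℂ) (hf : Measurable f) (hfb : ∃ C, ∀ x, ‖f x‖ ≤ C)
    (hint : ∫ x, f x ∂μ = 0) :
    Tendsto (fun T' : ℝ => (1 / T') *
        ∫ t in Set.Ioc (0:ℝ) T',
          ∫ x, ‖∑' j, (c j : ℂ) * f (S.T (fun _ => t * α j) x)‖ ^ 2 ∂μ)
      atTop (nhds ((∑' j, (c j) ^ 2) * ∫ x, ‖f x‖ ^ 2 ∂μ)) := by
  obtain ⟨C, hC⟩ := hfb
  have hfL : MemLp f 2 μ := MemLp.of_bound hf.aestronglyMeasurable C (Eventually.of_forall hC)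
  set v : Lp ℂ 2 μ := hfL.toLp f with hv_def
  have hv : ∫ x, v x ∂μ = 0 := (integral_congr_ae hfL.coeFn_toLp).trans hint
  have hvv : inner ℂ v v = ((∫ x, ‖f x‖ ^ 2 ∂μ : ℝ) : ℂ) := by
    rw [L2.inner_def, ← integral_complex_ofReal]
    refine integral_congr_ae ?_
    filter_upwards [hfL.coeFn_toLp] with x hx
    rw [hx, inner_self_eq_norm_sq_to_K]
    simp
  have hcn : Summable fun j => ‖(c j : ℂ)‖ := by
    simpa [abs_of_pos (hc _)] using hsum.summable
  have hdn : Summable fun p : J × J => ‖(c p.1 : ℂ) * c p.2‖ :=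
    Summable.mul_norm (f := fun j => (c j : ℂ)) (g := fun j => (c j : ℂ)) hcn hcn
  set d : J × J → ℂ := fun p => (c p.1 : ℂ) * c p.2 with hd
  set ψ : J × J → ℝ → ℂ := fun p t => inner ℂ v (S.koopman (t * (α p.1 - α p.2)) v) with hψ
  have hψm : ∀ p, Measurable (ψ p) := fun p =>
    (S.measurable_inner_koopman v v).comp (measurable_id.mul_const _)
  have hψb : ∀ p t, ‖ψ p t‖ ≤ ‖v‖ * ‖v‖ := fun p t => by
    simpa using norm_inner_le_norm (𝕜 := ℂ) v (S.koopman (t * (α p.1 - α p.2)) v)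
  have hexp : ∀ t : ℝ, HasSum (fun p => d p * ψ p t)
      ((∫ x, ‖∑' j, (c j : ℂ) * f (S.T (fun _ => t * α j) x)‖ ^ 2 ∂μ : ℝ) : ℂ) := by
    intro t
    have h := S.hasSum_integral_norm_sq_combination hcn (fun j => t * α j) hf hC hfL hv_def
    simp only [← mul_sub] at h
    exact h
  have havg : ∀ T : ℝ, (((1 / T) * ∫ t in Set.Ioc (0:ℝ) T,
      ∫ x, ‖∑' j, (c j : ℂ) * f (S.T (fun _ => t * α j) x)‖ ^ 2 ∂μ : ℝ) : ℂ) =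
      ∑' p, d p * timeAverage (ψ p) T := by
    intro T
    have hdom := hasSum_integral_of_dominated_convergence
      (μ := volume.restrict (Set.Ioc (0 : ℝ) T))
      (F := fun p t => d p * ψ p t) (fun p _ => ‖d p‖ * (‖v‖ * ‖v‖))
      (fun p => ((hψm p).const_mul _).aestronglyMeasurable)
      (fun p => Eventually.of_forall fun t => by
        rw [norm_mul]
        gcongr
        exact hψb p t)
      (Eventually.of_forall fun t => hdn.mul_right _) (integrable_const _)
      (Eventually.of_forall hexp)
    rw [integral_complex_ofReal] at hdom
    have h := hdom.const_smul (1 / T)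
    rw [Complex.ofReal_mul, ← Complex.real_smul, ← h.tsum_eq]
    simp only [timeAverage, integral_const_mul, mul_smul_comm]
  have hlim : ∀ p : J × J, Tendsto (timeAverage (ψ p)) atTop
      (𝓝 (Set.indicator (Set.range fun j : J => (j, j)) (fun _ => inner ℂ v v) p)) := by
    rintro ⟨j, k⟩
    by_cases hjk : j = k
    · subst hjk
      rw [Set.indicator_of_mem (Set.mem_range_self j)]
      refine tendsto_const_nhds.congr' ?_
      filter_upwards [eventually_gt_atTop 0] with T hT
      simp [timeAverage, hψ, S.koopman_zero, hT.le, hT.ne']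
    · rw [Set.indicator_of_notMem (by rintro ⟨i, hi⟩; grind)]
      exact hS.tendsto_timeAverage_correlation hv v (sub_ne_zero.2 (hα.ne hjk))
  have hmain := tendsto_tsum_of_dominated_convergence (𝓕 := atTop)
    (f := fun T p => d p * timeAverage (ψ p) T) (hdn.mul_right (‖v‖ * ‖v‖))
    (fun p => (hlim p).const_mul (d p)) (by
      filter_upwards [eventually_gt_atTop 0] with T hT p
      rw [norm_mul]
      gcongr
      exact norm_timeAverage_le (hψb p) hT)
  have hdiag : ∑' p, d p * Set.indicator (Set.range fun j : J => (j, j))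
      (fun _ => inner ℂ v v) p = (((∑' j, (c j) ^ 2) * ∫ x, ‖f x‖ ^ 2 ∂μ : ℝ) : ℂ) := by
    have hinj : Function.Injective fun j : J => (j, j) := fun i j h => congrArg Prod.fst h
    rw [← hinj.tsum_eq]
    · simp only [Set.indicator_of_mem (Set.mem_range_self _), tsum_mul_right, hvv, hd]
      push_cast
      simp only [sq]
    · intro p hp
      by_contra h
      refine hp ?_
      beta_reduce
      rw [Set.indicator_of_notMem h, mul_zero]
  rw [hdiag] at hmain
  simp only [← havg] at hmain
  exact Complex.continuous_re.continuousAt.tendsto.comp hmain
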